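/- arXiv:1706.05070 — 3 statements merged into one kernel-verified Lean document; each statement's English description precedes it below -/
import Mathlib

section
/- Let G₁ be an immediate descendant of G₂ and let a ∈ X be a witness for G₁ and G₂ (G₁ a ≠ G₂ a). Then: (1) G₁ a = false and G₂ a = true; (2) for every f ∈ S(G₁), f a = false; (3) for every f ∈ S(G₂) \ S(G₁), f a = true. -/
namespace Spex

variable {X : Type*}

/-- `F₁ ⇒ F₂`: `F₁` logically implies `F₂`. -/
def Imp (F₁ F₂ : X → Bool) : Prop := ∀ x, F₁ x = true → F₂ x = true

/-- The pointwise disjunction `⋁S` of a set of boolean functions, as a predicate on `X`. -/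
def DisjOn (S : Set (X → Bool)) (x : X) : Prop := ∃ f ∈ S, f x = true

/-- `S(P) = {f ∈ ℱ | f ⇒ P}` for a `Prop`-valued target `P`. -/
def SOfP (ℱ : Set (X → Bool)) (P : X → Prop) : Set (X → Bool) :=
  {f | f ∈ ℱ ∧ ∀ x, f x = true → P x}

/-- `S(G) = {f ∈ ℱ | f ⇒ G}`. -/
def SOf (ℱ : Set (X → Bool)) (G : X → Bool) : Set (X → Bool) :=
  SOfP ℱ (fun x => G x = true)

/-- `G` is a representative: `G = ⋁{f ∈ ℱ | f ⇒ G}` pointwise. -/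
def IsRep (ℱ : Set (X → Bool)) (G : X → Bool) : Prop :=
  ∀ x, G x = true ↔ DisjOn (SOf ℱ G) x

/-- A `Prop`-valued function is a representative: `P = ⋁{f ∈ ℱ | f ⇒ P}` pointwise. -/
def IsRepP (ℱ : Set (X → Bool)) (P : X → Prop) : Prop :=
  ∀ x, P x ↔ DisjOn (SOfP ℱ P) x

/-- `G₁` is a descendant of `G₂`. -/
def Desc (ℱ : Set (X → Bool)) (G₁ G₂ : X → Bool) : Prop :=
  IsRep ℱ G₁ ∧ IsRep ℱ G₂ ∧ Imp G₁ G₂ ∧ G₁ ≠ G₂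

/-- `G₁` is an immediate descendant of `G₂`. -/
def ImmDesc (ℱ : Set (X → Bool)) (G₁ G₂ : X → Bool) : Prop :=
  Desc ℱ G₁ G₂ ∧
    ¬ ∃ G : X → Bool, IsRep ℱ G ∧ Imp G₁ G ∧ Imp G G₂ ∧ G ≠ G₁ ∧ G ≠ G₂

/-- `Z(G,X') = {f ∈ S(G) | f(X') = 0}`. -/
def ZSet (ℱ : Set (X → Bool)) (G : X → Bool) (X' : Set X) : Set (X → Bool) :=
  {f | f ∈ SOf ℱ G ∧ ∀ x ∈ X', f x = false}

/-- Joining a member of `ℱ` to a representative gives a representative. -/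
theorem IsRep.or_mem {ℱ : Set (X → Bool)} {G f : X → Bool} (hG : IsRep ℱ G) (hf : f ∈ ℱ) :
    IsRep ℱ (fun x => G x || f x) := by
  intro x
  constructor
  · intro hx
    rcases Bool.or_eq_true_iff.mp hx with hx | hx
    · obtain ⟨g, ⟨hg, hgG⟩, hgx⟩ := (hG x).mp hx
      exact ⟨g, ⟨hg, fun y hy => Bool.or_eq_true_iff.mpr (Or.inl (hgG y hy))⟩, hgx⟩
    · exact ⟨f, ⟨hf, fun y hy => Bool.or_eq_true_iff.mpr (Or.inr hy)⟩, hx⟩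
  · rintro ⟨g, ⟨-, hgG⟩, hgx⟩
    exact hgG x hgx

theorem stmt7 (ℱ : Set (X → Bool)) (hfin : ℱ.Finite) (G₁ G₂ : X → Bool)
    (himm : ImmDesc ℱ G₁ G₂) (a : X) (hw : G₁ a ≠ G₂ a) :
    G₁ a = false ∧ G₂ a = true ∧
    (∀ f ∈ SOf ℱ G₁, f a = false) ∧
    (∀ f ∈ SOf ℱ G₂ \ SOf ℱ G₁, f a = true) := by
  obtain ⟨⟨hG₁, -, himp, -⟩, hno⟩ := himm
  have h₁ : G₁ a = false := by
    by_contra h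
    rw [Bool.not_eq_false] at h
    exact hw (h.trans (himp a h).symm)
  have h₂ : G₂ a = true := by
    by_contra h
    rw [Bool.not_eq_true] at h
    exact hw (h₁.trans h.symm)
  refine ⟨h₁, h₂, ?_, ?_⟩
  · rintro f ⟨-, hf⟩
    by_contra h
    rw [Bool.not_eq_false] at h
    exact Bool.false_ne_true (h₁.symm.trans (hf a h))
  · rintro f ⟨⟨hf, hfG₂⟩, hfG₁⟩
    by_contra h
    refine hno ⟨fun x => G₁ x || f x, hG₁.or_mem hf, ?_, ?_, ?_, ?_⟩
    · exact fun x hx => Bool.or_eq_true_iff.mpr (Or.inl hx)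
    · exact fun x hx => (Bool.or_eq_true_iff.mp hx).elim (himp x) (hfG₂ x)
    · intro heq
      refine hfG₁ ⟨hf, fun x hx => ?_⟩
      exact (congrFun heq x).symm.trans (Bool.or_eq_true_iff.mpr (Or.inr hx))
    · intro heq
      rcases Bool.or_eq_true_iff.mp ((congrFun heq a).trans h₂) with h' | h'
      · exact hw (h'.trans h₂.symm)
      · exact h h'

end Spex
end

section
/- Let G₁, G₂, …, G_t be pairwise distinct immediate descendants of a representative G. If a ∈ X is a witness for G₁ and G (G₁ a ≠ G a), then a is not a witness for G_i and G for any i > 1; that is, G₁ a = false, G a = true, and G_i a = true for all i = 2, …, t. -/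
namespace Spex

variable {X : Type*}

/-- The pointwise disjunction of two representatives is a representative. -/
theorem IsRep.or {ℱ : Set (X → Bool)} {F G : X → Bool} (hF : IsRep ℱ F) (hG : IsRep ℱ G) :
    IsRep ℱ (fun x => F x || G x) := by
  intro x
  constructor
  · intro hx
    rcases (Bool.or_eq_true _ _).mp hx with h | h
    · obtain ⟨f, ⟨hf, himp⟩, hfx⟩ := (hF x).mp h
      exact ⟨f, ⟨hf, fun y hy => by simp [himp y hy]⟩, hfx⟩
    · obtain ⟨f, ⟨hf, himp⟩, hfx⟩ := (hG x).mp h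
      exact ⟨f, ⟨hf, fun y hy => by simp [himp y hy]⟩, hfx⟩
  · rintro ⟨f, ⟨-, himp⟩, hfx⟩
    exact himp x hfx

/-- A representative between an immediate descendant of `G` and `G` that differs from `G`
is the immediate descendant itself. -/
theorem ImmDesc.eq_of_imp {ℱ : Set (X → Bool)} {F G H : X → Bool} (hF : ImmDesc ℱ F G)
    (hH : IsRep ℱ H) (hFH : Imp F H) (hHG : Imp H G) (hne : H ≠ G) : H = F := by
  by_contra h
  exact hF.2 ⟨H, hH, hFH, hHG, h, hne⟩

/-- Two distinct immediate descendants of `G` cover `G`. -/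
theorem ImmDesc.or_eq {ℱ : Set (X → Bool)} {F₁ F₂ G : X → Bool} (h₁ : ImmDesc ℱ F₁ G)
    (h₂ : ImmDesc ℱ F₂ G) (hne : F₁ ≠ F₂) : (fun x => F₁ x || F₂ x) = G := by
  by_contra h
  have hrep := h₁.1.1.or h₂.1.1
  have himp : Imp (fun x => F₁ x || F₂ x) G := fun x hx =>
    ((Bool.or_eq_true _ _).mp hx).elim (h₁.1.2.2.1 x) (h₂.1.2.2.1 x)
  have e₁ := h₁.eq_of_imp hrep (fun x hx => by simp [hx]) himp h
  have e₂ := h₂.eq_of_imp hrep (fun x hx => by simp [hx]) himp h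
  exact hne (e₁.symm.trans e₂)

theorem stmt8 (ℱ : Set (X → Bool)) (hfin : ℱ.Finite) (G : X → Bool)
    (t : ℕ) (ht : 0 < t) (Gs : Fin t → X → Bool)
    (hinj : Function.Injective Gs) (himm : ∀ i, ImmDesc ℱ (Gs i) G)
    (a : X) (hw : Gs ⟨0, ht⟩ a ≠ G a) :
    Gs ⟨0, ht⟩ a = false ∧ G a = true ∧
      ∀ i : Fin t, i ≠ ⟨0, ht⟩ → Gs i a = true := by
  have himp := (himm ⟨0, ht⟩).1.2.2.1 a
  have h₀ : Gs ⟨0, ht⟩ a = false := by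
    by_contra h
    have h' := Bool.eq_true_of_not_eq_false h
    exact hw (h'.trans (himp h').symm)
  have hG : G a = true := by
    by_contra h
    exact hw (h₀.trans (Bool.eq_false_of_not_eq_true h).symm)
  refine ⟨h₀, hG, fun i hi => ?_⟩
  have hor := congrFun ((himm ⟨0, ht⟩).or_eq (himm i) fun h => hi (hinj h).symm) a
  simpa [h₀, hG] using hor

end Spex
end

section
/- Let G' be an immediate descendant of a representative G, let a ∈ X be a witness for G and G' (G a ≠ G' a), and let G'' be a representative that is a descendant of G. Then: (1) if G'' a = false, then G'' ⇒ G' (G'' is a descendant of G' or equal to G'), and in particular S(G'') ⊆ S(G'); (2) if G'' a = true, then G'' is neither a descendant of G' nor equal to G', and in particular S(G'') ⊄ S(G'). -/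
namespace Spex

variable {X : Type*}

theorem Imp.trans {F₁ F₂ F₃ : X → Bool} (h₁ : Imp F₁ F₂) (h₂ : Imp F₂ F₃) : Imp F₁ F₃ :=
  fun x hx => h₂ x (h₁ x hx)

theorem SOf_mono {ℱ : Set (X → Bool)} {F₁ F₂ : X → Bool} (h : Imp F₁ F₂) :
    SOf ℱ F₁ ⊆ SOf ℱ F₂ :=
  fun _ hf => ⟨hf.1, Imp.trans hf.2 h⟩

theorem IsRep.imp_of_SOf_subset {ℱ : Set (X → Bool)} {F₁ F₂ : X → Bool} (h₁ : IsRep ℱ F₁)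
    (h : SOf ℱ F₁ ⊆ SOf ℱ F₂) : Imp F₁ F₂ := by
  intro x hx
  obtain ⟨f, hf, hfx⟩ := (h₁ x).1 hx
  exact (h hf).2 x hfx

theorem imp_or_left (F₁ F₂ : X → Bool) : Imp F₁ (fun x => F₁ x || F₂ x) :=
  fun x hx => by simp [hx]

theorem imp_or_right (F₁ F₂ : X → Bool) : Imp F₂ (fun x => F₁ x || F₂ x) :=
  fun x hx => by simp [hx]

theorem or_imp {F₁ F₂ F : X → Bool} (h₁ : Imp F₁ F) (h₂ : Imp F₂ F) :
    Imp (fun x => F₁ x || F₂ x) F :=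
  fun x hx => ((Bool.or_eq_true _ _).mp hx).elim (h₁ x) (h₂ x)

/-- Representatives are closed under pointwise disjunction. -/
theorem IsRep.or_s9 {ℱ : Set (X → Bool)} {F₁ F₂ : X → Bool} (h₁ : IsRep ℱ F₁)
    (h₂ : IsRep ℱ F₂) : IsRep ℱ (fun x => F₁ x || F₂ x) := by
  intro x
  constructor
  · intro hx
    rcases (Bool.or_eq_true _ _).mp hx with hx | hx
    · obtain ⟨f, hf, hfx⟩ := (h₁ x).1 hx
      exact ⟨f, SOf_mono (imp_or_left F₁ F₂) hf, hfx⟩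
    · obtain ⟨f, hf, hfx⟩ := (h₂ x).1 hx
      exact ⟨f, SOf_mono (imp_or_right F₁ F₂) hf, hfx⟩
  · rintro ⟨f, hf, hfx⟩
    exact hf.2 x hfx

theorem stmt9 (ℱ : Set (X → Bool)) (hfin : ℱ.Finite) (G G' G'' : X → Bool)
    (himm : ImmDesc ℱ G' G) (a : X) (hw : G a ≠ G' a)
    (hdesc : Desc ℱ G'' G) :
    (G'' a = false → (Imp G'' G' ∧ SOf ℱ G'' ⊆ SOf ℱ G')) ∧
    (G'' a = true → (G'' ≠ G' ∧ ¬ Desc ℱ G'' G' ∧ ¬ SOf ℱ G'' ⊆ SOf ℱ G')) := by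
  obtain ⟨⟨hG', -, hG'G, -⟩, hnone⟩ := himm
  obtain ⟨hG'', -, hG''G, -⟩ := hdesc
  have hG'a : G' a = false := by
    by_contra hne
    have h : G' a = true := by simpa using hne
    exact hw ((hG'G a h).trans h.symm)
  have hGa : G a = true := by simpa [hG'a] using hw
  refine ⟨fun ha => ?_, fun ha => ?_⟩
  · have hor : (fun x => G' x || G'' x) = G' := by
      by_contra hne
      refine hnone ⟨_, hG'.or_s9 hG'', imp_or_left G' G'', or_imp hG'G hG''G, hne, fun h => ?_⟩
      have := congrFun h a
      simp [hG'a, ha, hGa] at this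
    have himp : Imp G'' G' := by
      simpa only [hor] using imp_or_right G' G''
    exact ⟨himp, SOf_mono himp⟩
  · have hnot : ¬ Imp G'' G' := fun h => by simpa [hG'a] using h a ha
    exact ⟨fun h => hnot (h ▸ fun _ hx => hx), fun h => hnot h.2.2.1,
      fun h => hnot (hG''.imp_of_SOf_subset h)⟩

end Spex
end
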